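/- Extend ∂̄_F and ∂ z-coefficientwise to PV_S[z] and set D := ∂̄_F + z·∂. Define the operator E on PV_S[z] by E(a) := z²·(da/dz) − F ∧ a, where d/dz is the formal derivative in z. Then E ∘ D − D ∘ E = z·D as operators on PV_S[z]. (This is the commutation [∇^{PV}_{∂/∂z}, ∂̄_F + z∂] = z^{−1}(∂̄_F + z∂), after clearing denominators.) -/

import Mathlib

open MvPolynomial TensorProduct

set_option synthInstance.maxHeartbeats 1000000

noncomputable section

/-- The variables of `R_S[z]`: the `x`-variables, the unfolding parameters `s`, and `z`. -/
abbrev SVars (N μ : ℕ) := (Fin N ⊕ Fin μ) ⊕ Unit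

/-- `R_S[z]`, realized as the polynomial ring `ℂ[x₁,…,x_N,s₁,…,s_μ,z]`. -/
abbrev RSz (N μ : ℕ) := MvPolynomial (SVars N μ) ℂ

/-- The `x`-variables inside `R_S[z]`. -/
def xvar {N μ : ℕ} (k : Fin N) : SVars N μ := Sum.inl (Sum.inl k)

/-- The `s`-variables inside `R_S[z]`. -/
def svar {N μ : ℕ} (α : Fin μ) : SVars N μ := Sum.inl (Sum.inr α)

/-- The variable `z` inside `R_S[z]`. -/
def zvar {N μ : ℕ} : SVars N μ := Sum.inr ()

/-- The inclusion `R = ℂ[x₁,…,x_N] → R_S[z]`. -/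
def toRSz {N μ : ℕ} (p : MvPolynomial (Fin N) ℂ) : RSz N μ :=
  rename (xvar : Fin N → SVars N μ) p

/-- The unfolding `F = f + Σ_α s_α·φ_α ∈ R_S`. -/
def unfold {N μ : ℕ} (f : MvPolynomial (Fin N) ℂ) (φ : Fin μ → MvPolynomial (Fin N) ℂ) :
    RSz N μ :=
  toRSz f + ∑ α, X (svar α) * toRSz (φ α)

/-- The exterior algebra `⋀(ℂ^N)` on the generators `θ₁,…,θ_N`. -/
abbrev ExtN (N : ℕ) := ExteriorAlgebra ℂ (Fin N → ℂ)

/-- `PV_S[z] = R_S[z] ⊗ ⋀(ℂ^N)`. -/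
abbrev PVSz (N μ : ℕ) := RSz N μ ⊗[ℂ] ExtN N

/-- Contraction (interior product) with the `k`-th dual covector. -/
def contr {N : ℕ} (k : Fin N) : ExtN N →ₗ[ℂ] ExtN N :=
  CliffordAlgebra.contractLeft (LinearMap.proj k)

/-- The twisted differential `D = ∂̄_F + z∂` on `PV_S[z]`, acting by
`α ⊗ ω ↦ Σ_k ((∂F/∂x_k)·α + z·∂α/∂x_k) ⊗ ι_k(ω)` (derivatives in the `x`-variables). -/
def DopS {N μ : ℕ} (f : MvPolynomial (Fin N) ℂ) (φ : Fin μ → MvPolynomial (Fin N) ℂ) :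
    PVSz N μ →ₗ[ℂ] PVSz N μ :=
  ∑ k : Fin N, TensorProduct.map
    (LinearMap.mulLeft ℂ (pderiv (xvar k) (unfold f φ)) +
      LinearMap.mulLeft ℂ (X zvar) ∘ₗ (pderiv (xvar k)).toLinearMap)
    (contr k)

/-- The operator `E(a) = z²·(da/dz) − F ∧ a` on `PV_S[z]` (i.e. `z²∇^{PV}_{∂/∂z}`). -/
def Eop {N μ : ℕ} (f : MvPolynomial (Fin N) ℂ) (φ : Fin μ → MvPolynomial (Fin N) ℂ) :
    PVSz N μ →ₗ[ℂ] PVSz N μ :=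
  TensorProduct.map (LinearMap.mulLeft ℂ ((X zvar : RSz N μ) ^ 2) ∘ₗ
      (pderiv (zvar : SVars N μ)).toLinearMap) LinearMap.id -
    LinearMap.mulLeft ℂ ((unfold f φ : RSz N μ) ⊗ₜ[ℂ] (1 : ExtN N))

theorem pderiv_z_toRSz {N μ : ℕ} (p : MvPolynomial (Fin N) ℂ) :
    pderiv (zvar : SVars N μ) (toRSz p) = 0 := by
  unfold toRSz
  induction p using MvPolynomial.induction_on with
  | C a => simp
  | add p q hp hq => simp [hp, hq]
  | mul_X p i hp =>
    simp only [map_mul, rename_X, Derivation.leibniz, hp, smul_zero, add_zero]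
    rw [pderiv_X_of_ne (by simp [xvar, zvar]), smul_zero]

theorem pderiv_z_unfold {N μ : ℕ} (f : MvPolynomial (Fin N) ℂ)
    (φ : Fin μ → MvPolynomial (Fin N) ℂ) :
    pderiv (zvar : SVars N μ) (_root_.unfold f φ) = 0 := by
  simp only [_root_.unfold, map_add, map_sum, Derivation.leibniz, pderiv_z_toRSz, smul_zero]
  simp only [zero_add]
  refine Finset.sum_eq_zero fun α _ => ?_
  rw [pderiv_X_of_ne (by simp [svar, zvar]), smul_zero]

theorem pderiv_swap {σ : Type*} (i j : σ) (p : MvPolynomial σ ℂ) :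
    pderiv i (pderiv j p) = pderiv j (pderiv i p) := by
  classical
  have h : ⁅(pderiv i : Derivation ℂ (MvPolynomial σ ℂ) (MvPolynomial σ ℂ)),
      (pderiv j : Derivation ℂ (MvPolynomial σ ℂ) (MvPolynomial σ ℂ))⁆ = 0 := by
    apply MvPolynomial.derivation_ext
    intro k
    simp only [Derivation.commutator_apply, pderiv_X, Pi.single_apply]
    split_ifs <;> simp
  have := congrArg (fun d => d p) h
  simpa [Derivation.commutator_apply, sub_eq_zero] using this

/-- The commutation relation `E∘D − D∘E = z·D` on `PV_S[z]`, i.e.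
`[∇^{PV}_{∂/∂z}, ∂̄_F + z∂] = z⁻¹(∂̄_F + z∂)` after clearing denominators. -/
theorem Eop_comm_DopS (N μ : ℕ) (hN : 0 < N) (hμ : 0 < μ)
    (f : MvPolynomial (Fin N) ℂ) (φ : Fin μ → MvPolynomial (Fin N) ℂ) :
    Eop f φ ∘ₗ DopS f φ - DopS f φ ∘ₗ Eop f φ =
      LinearMap.mulLeft ℂ ((X (zvar : SVars N μ) : RSz N μ) ⊗ₜ[ℂ] (1 : ExtN N)) ∘ₗ
        DopS f φ := by
  apply TensorProduct.ext'
  intro a w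
  have hz : ∀ k : Fin N, pderiv (xvar k) (X (zvar : SVars N μ) : RSz N μ) = 0 :=
    fun k => pderiv_X_of_ne (by simp [xvar, zvar])
  simp only [LinearMap.sub_apply, LinearMap.comp_apply, DopS, Eop, LinearMap.sum_apply,
    TensorProduct.map_tmul, map_sum, map_sub, LinearMap.mulLeft_apply,
    Algebra.TensorProduct.tmul_mul_tmul, one_mul, LinearMap.id_apply, LinearMap.add_apply,
    ← Finset.sum_sub_distrib]
  refine Finset.sum_congr rfl fun k _ => ?_
  simp only [← TensorProduct.sub_tmul]
  congr 1
  have hF := pderiv_z_unfold f φ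
  have hFk : pderiv (zvar : SVars N μ) (pderiv (xvar k) (_root_.unfold f φ)) = 0 := by
    rw [pderiv_swap, hF, map_zero]
  simp only [Derivation.coeFn_coe, map_add, Derivation.leibniz, Derivation.leibniz_pow, hz,
    hFk, pderiv_X_self, pderiv_swap zvar (xvar k) a, smul_eq_mul, smul_zero]
  ring
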